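/- Let D, e, g, N be positive integers, let A = (A_1,…,A_g) and R = (R_1,…,R_g) be g-tuples in M_D(ℂ), let C ∈ M_D(ℂ), and let 𝒲 be a D×e complex matrix. Suppose: (a) 𝒲^* C A_i R^ω 𝒲 = 0 for every 1 ≤ i ≤ g and every word ω with |ω| ≥ N; (b) (controllability) the vectors R^ω 𝒲 h, for ω a word and h ∈ ℂ^e, span ℂ^D; and (c) (observability) the intersection over all words w and all 1 ≤ j ≤ g of the kernels of 𝒲^* C A_j R^w is {0}. Then the tuple R is jointly nilpotent; indeed R^ξ = 0 for every word ξ with |ξ| ≥ N. -/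

import Mathlib

open scoped Matrix

/-- The product of matrices from the tuple `R` along the word `ω` (empty word ↦ identity). -/
noncomputable def wordProd {g D : ℕ} (R : Fin g → Matrix (Fin D) (Fin D) ℂ)
    (ω : List (Fin g)) : Matrix (Fin D) (Fin D) ℂ :=
  (ω.map R).prod

/-- If `𝒲^* C A_i R^ω 𝒲 = 0` for all words of length at least `N`, and the system
`(R, 𝒲, {𝒲^* C A_j})` is controllable and observable, then `R^ξ = 0` for every word `ξ`
with `|ξ| ≥ N`; in particular `R` is jointly nilpotent. -/
theorem polynomial_implies_nilpotent {D e g : ℕ} (hD : 0 < D) (he : 0 < e) (hg : 0 < g)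
    (N : ℕ) (hN : 0 < N)
    (A R : Fin g → Matrix (Fin D) (Fin D) ℂ)
    (C : Matrix (Fin D) (Fin D) ℂ)
    (𝒲 : Matrix (Fin D) (Fin e) ℂ)
    (hzero : ∀ (i : Fin g) (ω : List (Fin g)), N ≤ ω.length →
      𝒲ᴴ * C * A i * wordProd R ω * 𝒲 = 0)
    (hcontrol : Submodule.span ℂ
      {v : Fin D → ℂ | ∃ (ω : List (Fin g)) (x : Fin e → ℂ),
        v = (wordProd R ω * 𝒲).mulVec x} = ⊤)
    (hobs : (⨅ (w : List (Fin g)) (j : Fin g),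
      LinearMap.ker (Matrix.mulVecLin (𝒲ᴴ * C * A j * wordProd R w))) = ⊥) :
    ∀ ξ : List (Fin g), N ≤ ξ.length → wordProd R ξ = 0 := by
  intro ξ hξ
  have happ (u v : List (Fin g)) : wordProd R (u ++ v) = wordProd R u * wordProd R v := by
    simp [wordProd]
  have hspan : (⊤ : Submodule ℂ (Fin D → ℂ)) ≤ LinearMap.ker (wordProd R ξ).mulVecLin := by
    rw [← hcontrol, Submodule.span_le]
    rintro _ ⟨ω, x, rfl⟩
    rw [SetLike.mem_coe, LinearMap.mem_ker, ← Submodule.mem_bot ℂ, ← hobs]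
    simp only [Submodule.mem_iInf, LinearMap.mem_ker, Matrix.mulVecLin_apply,
      Matrix.mulVec_mulVec]
    intro w j
    have h := hzero j (w ++ (ξ ++ ω)) (by simp only [List.length_append]; omega)
    simp only [happ, Matrix.mul_assoc] at h ⊢
    rw [h, Matrix.zero_mulVec]
  have hker : LinearMap.ker (wordProd R ξ).mulVecLin = ⊤ := top_le_iff.mp hspan
  refine Matrix.ext_of_mulVec_single fun i => ?_
  rw [Matrix.zero_mulVec]
  exact LinearMap.congr_fun (LinearMap.ker_eq_top.mp hker) (Pi.single i 1)
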